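/- Let a ∈ ℓ²(ℤ, ℂ). For t ∈ ℝ, let π(t)a denote the sequence (a(n) e^{2πi n t})_{n ∈ ℤ}, which again lies in ℓ²(ℤ, ℂ). Then the map ℝ → ℓ²(ℤ, ℂ), t ↦ π(t)a, is infinitely differentiable (C^∞ as a map into the Hilbert space ℓ²(ℤ, ℂ)) if and only if a is rapidly decreasing. -/

import Mathlib

theorem aux_hasDerivAt {E : Type*} [NormedAddCommGroup E] [NormedSpace ℂ E] [NormedSpace ℝ E]
    [IsScalarTower ℝ ℂ E] (c : ℂ) (v : E) (t : ℝ) :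
    HasDerivAt (fun t : ℝ => Complex.exp (c * t) • v) (Complex.exp (c * t) • (c • v)) t := by
  have h0 : HasDerivAt (fun t : ℝ => (t : ℂ)) 1 t := Complex.ofRealCLM.hasDerivAt
  have h1 : HasDerivAt (fun t : ℝ => Complex.exp (c * t)) (Complex.exp (c * t) * (c * 1)) t :=
    (h0.const_mul c).cexp
  have h2 := h1.smul_const v
  rw [mul_one, mul_smul] at h2
  exact h2

theorem aux_iteratedDeriv {E : Type*} [NormedAddCommGroup E] [NormedSpace ℂ E] [NormedSpace ℝ E]
    [IsScalarTower ℝ ℂ E] (c : ℂ) (k : ℕ) : ∀ (v : E),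
    iteratedDeriv k (fun t : ℝ => Complex.exp (c * t) • v) =
      fun t : ℝ => Complex.exp (c * t) • (c ^ k • v) := by
  induction k with
  | zero => intro v; simp
  | succ k ih =>
    intro v
    rw [iteratedDeriv_succ']
    have : deriv (fun t : ℝ => Complex.exp (c * t) • v) =
        fun t : ℝ => Complex.exp (c * t) • (c • v) :=
      funext fun t => (aux_hasDerivAt c v t).deriv
    rw [this, ih, smul_smul, pow_succ]

theorem aux_contDiff {E : Type*} [NormedAddCommGroup E] [NormedSpace ℂ E] [NormedSpace ℝ E]
    [IsScalarTower ℝ ℂ E] (c : ℂ) (v : E) (n : WithTop ℕ∞) :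
    ContDiff ℝ n (fun t : ℝ => Complex.exp (c * t) • v) := by
  have h0 : ContDiff ℝ n (fun t : ℝ => (t : ℂ)) := Complex.ofRealCLM.contDiff
  exact ((contDiff_const.mul h0).cexp).smul contDiff_const

theorem aux_norm {E : Type*} [NormedAddCommGroup E] [NormedSpace ℂ E] [NormedSpace ℝ E]
    [IsScalarTower ℝ ℂ E] (n : ℤ) (k : ℕ) (v : E) (t : ℝ) :
    ‖iteratedFDeriv ℝ k
      (fun t : ℝ => Complex.exp (2 * Real.pi * Complex.I * n * t) • v) t‖ =
      (2 * Real.pi * |(n : ℝ)|) ^ k * ‖v‖ := by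
  rw [norm_iteratedFDeriv_eq_norm_iteratedDeriv, aux_iteratedDeriv, norm_smul, norm_smul]
  have h1 : ‖Complex.exp (2 * Real.pi * Complex.I * n * t)‖ = 1 := by
    rw [Complex.norm_exp]; simp
  have h2 : ‖(2 * Real.pi * Complex.I * n : ℂ)‖ = 2 * Real.pi * |(n : ℝ)| := by
    simp [abs_of_pos Real.pi_pos]
  rw [h1, norm_pow, h2, one_mul]

theorem aux_summable : Summable fun n : ℤ => ((1 + |(n : ℝ)|) ^ 2)⁻¹ := by
  have h := (Real.summable_one_div_int_pow (p := 2)).2 (by norm_num)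
  refine Summable.of_norm_bounded_eventually h ?_
  have : ({0} : Set ℤ)ᶜ ∈ Filter.cofinite := (Set.finite_singleton 0).compl_mem_cofinite
  filter_upwards [this] with n hn
  have hn0 : (n : ℝ) ≠ 0 := by exact_mod_cast hn
  have hp : 0 < |(n : ℝ)| := abs_pos.2 hn0
  rw [Real.norm_of_nonneg (by positivity), one_div, ← sq_abs (n : ℝ)]
  gcongr
  linarith

theorem stmt_9 (a : lp (fun _ : ℤ => ℂ) 2)
    (F : ℝ → lp (fun _ : ℤ => ℂ) 2)
    (hF : ∀ (t : ℝ) (n : ℤ),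
      (F t : ∀ _ : ℤ, ℂ) n = (a : ∀ _ : ℤ, ℂ) n * Complex.exp (2 * Real.pi * Complex.I * n * t)) :
    ContDiff ℝ (⊤ : ℕ∞) F ↔
      ∀ k : ℕ, ∃ C : ℝ, 0 < C ∧
        ∀ n : ℤ, ‖(a : ∀ _ : ℤ, ℂ) n‖ ≤ C * ((1 + |(n : ℝ)|) ^ k)⁻¹ := by
  constructor
  · intro h k
    refine ⟨‖a‖ + ‖iteratedFDeriv ℝ k F 0‖ + 1, by positivity, fun n => ?_⟩
    rw [← div_eq_mul_inv, le_div_iff₀ (by positivity)]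
    by_cases hn : n = 0
    · subst hn
      have := lp.norm_apply_le_norm two_ne_zero a 0
      have h2 := norm_nonneg (iteratedFDeriv ℝ k F 0)
      simp
      linarith
    · have hL : ‖lp.evalCLM ℝ (fun _ : ℤ => ℂ) 2 n‖ ≤ 1 :=
        LinearMap.mkContinuous_norm_le _ zero_le_one _
      have h1 := (lp.evalCLM ℝ (fun _ : ℤ => ℂ) 2 n).norm_iteratedFDeriv_comp_left
        (h.contDiffAt (x := 0)) (n := k) (by exact_mod_cast le_top)
      have h3 : (lp.evalCLM ℝ (fun _ : ℤ => ℂ) 2 n) ∘ F =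
          fun t : ℝ => Complex.exp (2 * Real.pi * Complex.I * n * t) • a n := by
        funext t
        rw [smul_eq_mul, mul_comm, ← hF]
        rfl
      rw [h3, aux_norm] at h1
      have h4 : (1 : ℝ) ≤ |(n : ℝ)| := by
        exact_mod_cast Int.one_le_abs hn
      have h5 : 1 + |(n : ℝ)| ≤ 2 * Real.pi * |(n : ℝ)| := by
        nlinarith [Real.pi_gt_three]
      calc ‖a n‖ * (1 + |(n : ℝ)|) ^ k ≤ ‖a n‖ * (2 * Real.pi * |(n : ℝ)|) ^ k := by gcongr
        _ = (2 * Real.pi * |(n : ℝ)|) ^ k * ‖a n‖ := mul_comm _ _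
        _ ≤ _ := h1
        _ ≤ 1 * ‖iteratedFDeriv ℝ k F 0‖ := by gcongr
        _ ≤ _ := by linarith [norm_nonneg a]
  · intro h
    choose C hC hb using h
    have hFe : F = fun t : ℝ => ∑' n : ℤ,
        Complex.exp (2 * Real.pi * Complex.I * n * t) • lp.single 2 n (a n) := by
      funext t
      rw [← (lp.hasSum_single (by norm_num) (F t)).tsum_eq]
      congr 1
      funext n
      rw [hF, ← lp.single_smul, smul_eq_mul, mul_comm]
    rw [hFe]
    refine contDiff_tsum
      (v := fun (k : ℕ) (n : ℤ) => (2 * Real.pi) ^ k * C (k + 2) * ((1 + |(n : ℝ)|) ^ 2)⁻¹)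
      (fun n => aux_contDiff _ _ _) (fun k _ => aux_summable.mul_left _) ?_
    intro k n t _
    rw [aux_norm, lp.norm_single (by norm_num), mul_pow]
    have hp : 0 < 1 + |(n : ℝ)| := by positivity
    calc (2 * Real.pi) ^ k * |(n : ℝ)| ^ k * ‖a n‖
        ≤ (2 * Real.pi) ^ k * (1 + |(n : ℝ)|) ^ k *
          (C (k + 2) * ((1 + |(n : ℝ)|) ^ (k + 2))⁻¹) := by
          gcongr
          · linarith
          · exact hb _ _
      _ = _ := by
          field_simp
          ring
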